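/- The bilevel wind power generation planning problem has an optimal solution: among all tuples consisting of an investment decision (x, u) with x_i ∈ {0,1}, 0 ≤ u_i ≤ Ū_i x_i for i ∈ Ψ, Σ_{i∈Ψ}(C_i u_i + H_i x_i) ≤ Ĉ, together with, for each demand block t ∈ T, a market-clearing solution for block t and capacities u that minimizes the market-clearing cost of block t, there exists one that maximizes the upper-level objective κ Σ_{t∈T} L_t Σ_{i∈Ψ} g^w_{i,t} − Σ_{i∈Ψ}(c_i u_i + h_i x_i) (Proposition 1(ii)). -/

import Mathlib

open Finset

variable {I L Ω T : Type*} [Fintype I] [Fintype L] [Fintype Ω] [Fintype T] [DecidableEq I]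

/-- Data of a DC power network over a finite set `T` of demand blocks. -/
structure MultiNetwork (I L Ω T : Type*)
    [Fintype I] [Fintype L] [Fintype Ω] [Fintype T] where
  o : L → I
  d : L → I
  D : T → I → ℝ
  loc : Ω → I
  P : Ω → ℝ
  Ψ : Finset I
  k : T → I → ℝ
  S : L → ℝ
  fbar : L → ℝ
  θbar : ℝ
  hD : ∀ t i, 0 ≤ D t i
  hP : ∀ j, 0 ≤ P j
  hk : ∀ t i, 0 ≤ k t i ∧ k t i ≤ 1
  hfbar : ∀ l, 0 < fbar l
  hθbar : 0 < θbar

/-- A market-clearing solution for demand block `t` and installed wind capacities `u`. -/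
def IsMarketClearing (N : MultiNetwork I L Ω T) (t : T) (u : I → ℝ)
    (g : Ω → ℝ) (gw : I → ℝ) (s : I → ℝ) (f : L → ℝ) (θ : I → ℝ) (z : L → ℝ) : Prop :=
  (∀ j, 0 ≤ g j ∧ g j ≤ N.P j) ∧
  (∀ i ∈ N.Ψ, 0 ≤ gw i ∧ gw i ≤ N.k t i * u i) ∧
  (∀ i, i ∉ N.Ψ → gw i = 0) ∧
  (∀ i, 0 ≤ s i) ∧
  (∀ l, -N.fbar l ≤ f l ∧ f l ≤ N.fbar l) ∧
  (∀ i, -N.θbar ≤ θ i ∧ θ i ≤ N.θbar) ∧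
  (∀ l, z l = 0 ∨ z l = 1) ∧
  (∀ i, (∑ j ∈ univ.filter (fun j => N.loc j = i), g j) + gw i
      + (∑ l ∈ univ.filter (fun l => N.d l = i), f l) + s i
      = N.D t i + ∑ l ∈ univ.filter (fun l => N.o l = i), f l) ∧
  (∀ l, f l = N.S l * (θ (N.o l) - θ (N.d l)) * z l)

/-- Market-clearing cost of one demand block. -/
def clearingCost (p : Ω → ℝ) (ρ : I → ℝ) (g : Ω → ℝ) (s : I → ℝ) : ℝ :=
  (∑ j, p j * g j) + ∑ i, ρ i * s i

/-- Feasibility for the bilevel problem: a binary siting decision `x` and capacities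
`u` satisfying the installation bounds and the budget constraint, together with, for
each demand block `t`, a market-clearing solution that minimizes the market-clearing
cost of block `t` among all market-clearing solutions of block `t` for capacities `u`. -/
def Admissible (N : MultiNetwork I L Ω T) (p : Ω → ℝ) (ρ : I → ℝ)
    (Ubar C H : I → ℝ) (Chat : ℝ) (x u : I → ℝ)
    (g : T → Ω → ℝ) (gw s : T → I → ℝ) (f : T → L → ℝ)
    (θ : T → I → ℝ) (z : T → L → ℝ) : Prop :=
  (∀ i, x i = 0 ∨ x i = 1) ∧
  (∀ i ∈ N.Ψ, 0 ≤ u i ∧ u i ≤ Ubar i * x i) ∧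
  (∑ i ∈ N.Ψ, (C i * u i + H i * x i)) ≤ Chat ∧
  (∀ t, IsMarketClearing N t u (g t) (gw t) (s t) (f t) (θ t) (z t)) ∧
  (∀ t, ∀ g' gw' s' f' θ' z', IsMarketClearing N t u g' gw' s' f' θ' z' →
    clearingCost p ρ (g t) (s t) ≤ clearingCost p ρ g' s')

/-- The market-clearing constraints define a closed set, jointly in all variables. -/
lemma isClosed_setOf_isMarketClearing {X : Type*} [TopologicalSpace X]
    (N : MultiNetwork I L Ω T) (t : T) {u : X → I → ℝ} {g : X → Ω → ℝ} {gw s : X → I → ℝ}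
    {f : X → L → ℝ} {θ : X → I → ℝ} {z : X → L → ℝ}
    (hu : Continuous u) (hg : Continuous g) (hgw : Continuous gw) (hs : Continuous s)
    (hf : Continuous f) (hθ : Continuous θ) (hz : Continuous z) :
    IsClosed {a | IsMarketClearing N t (u a) (g a) (gw a) (s a) (f a) (θ a) (z a)} := by
  simp only [IsMarketClearing, Set.ofPred_and, Set.ofPred_forall, Set.ofPred_or]
  refine IsClosed.inter ?_ <| IsClosed.inter ?_ <| IsClosed.inter ?_ <| IsClosed.inter ?_ <|
    IsClosed.inter ?_ <| IsClosed.inter ?_ <| IsClosed.inter ?_ <| IsClosed.inter ?_ ?_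
  · exact isClosed_iInter fun j => (isClosed_le (by fun_prop) (by fun_prop)).inter
      (isClosed_le (by fun_prop) (by fun_prop))
  · exact isClosed_iInter fun i => isClosed_iInter fun _ =>
      (isClosed_le (by fun_prop) (by fun_prop)).inter (isClosed_le (by fun_prop) (by fun_prop))
  · exact isClosed_iInter fun i => isClosed_iInter fun _ =>
      isClosed_eq (by fun_prop) (by fun_prop)
  · exact isClosed_iInter fun i => isClosed_le (by fun_prop) (by fun_prop)
  · exact isClosed_iInter fun l => (isClosed_le (by fun_prop) (by fun_prop)).inter
      (isClosed_le (by fun_prop) (by fun_prop))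
  · exact isClosed_iInter fun i => (isClosed_le (by fun_prop) (by fun_prop)).inter
      (isClosed_le (by fun_prop) (by fun_prop))
  · exact isClosed_iInter fun l => (isClosed_eq (by fun_prop) (by fun_prop)).union
      (isClosed_eq (by fun_prop) (by fun_prop))
  · exact isClosed_iInter fun i => isClosed_eq (by fun_prop) (by fun_prop)
  · exact isClosed_iInter fun l => isClosed_eq (by fun_prop) (by fun_prop)

/-- An upper bound for the load shedding at bus `i` in block `t`. -/
def sheddingBound (N : MultiNetwork I L Ω T) (t : T) (i : I) : ℝ :=
  N.D t i + (∑ l ∈ univ.filter (fun l => N.o l = i), N.fbar l)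
    + ∑ l ∈ univ.filter (fun l => N.d l = i), N.fbar l

namespace IsMarketClearing

variable {N : MultiNetwork I L Ω T} {t : T} {u : I → ℝ} {g : Ω → ℝ} {gw s : I → ℝ}
  {f : L → ℝ} {θ : I → ℝ} {z : L → ℝ}

lemma wind_nonneg (hm : IsMarketClearing N t u g gw s f θ z) (i : I) : 0 ≤ gw i := by
  by_cases hi : i ∈ N.Ψ
  · exact (hm.2.1 i hi).1
  · exact (hm.2.2.1 i hi).ge

lemma wind_le (hm : IsMarketClearing N t u g gw s f θ z) {U : I → ℝ} (hU : ∀ i, 0 ≤ U i)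
    (hu : ∀ i ∈ N.Ψ, 0 ≤ u i ∧ u i ≤ U i) (i : I) : gw i ≤ U i := by
  by_cases hi : i ∈ N.Ψ
  · exact (hm.2.1 i hi).2.trans
      ((mul_le_of_le_one_left (hu i hi).1 (N.hk t i).2).trans (hu i hi).2)
  · exact (hm.2.2.1 i hi).trans_le (hU i)

lemma shedding_le (hm : IsMarketClearing N t u g gw s f θ z) (i : I) :
    s i ≤ sheddingBound N t i := by
  have h1 : 0 ≤ ∑ j ∈ univ.filter (fun j => N.loc j = i), g j :=
    sum_nonneg fun j _ => (hm.1 j).1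
  have h2 := hm.wind_nonneg i
  obtain ⟨-, -, -, -, hf, -, -, hb, -⟩ := hm
  have h3 : ∑ l ∈ univ.filter (fun l => N.o l = i), f l
      ≤ ∑ l ∈ univ.filter (fun l => N.o l = i), N.fbar l := sum_le_sum fun l _ => (hf l).2
  have h4 : ∑ l ∈ univ.filter (fun l => N.d l = i), -N.fbar l
      ≤ ∑ l ∈ univ.filter (fun l => N.d l = i), f l := sum_le_sum fun l _ => (hf l).1
  rw [sum_neg_distrib] at h4
  have := hb i
  unfold sheddingBound
  linarith

lemma switching_mem (hm : IsMarketClearing N t u g gw s f θ z) (l : L) :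
    0 ≤ z l ∧ z l ≤ 1 := by
  rcases hm.2.2.2.2.2.2.1 l with h | h <;> simp [h]

/-- Curtailing the wind production to what capacities `v` allow, and shedding the difference,
turns a market-clearing solution into one for capacities `v`. -/
lemma curtail (hm : IsMarketClearing N t u g gw s f θ z) {v : I → ℝ}
    (hv : ∀ i ∈ N.Ψ, 0 ≤ v i) (hv' : ∀ i, i ∉ N.Ψ → v i = 0) :
    IsMarketClearing N t v g (fun i => min (gw i) (N.k t i * v i))
      (fun i => s i + (gw i - min (gw i) (N.k t i * v i))) f θ z := by
  have hw := hm.wind_nonneg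
  obtain ⟨h1, -, h3, h4, h5, h6, h7, h8, h9⟩ := hm
  refine ⟨h1, fun i hi => ⟨le_min (hw i) (mul_nonneg (N.hk t i).1 (hv i hi)), min_le_right _ _⟩,
    fun i hi => by simp [h3 i hi, hv' i hi], fun i => ?_, h5, h6, h7, fun i => ?_, h9⟩
  · exact add_nonneg (h4 i) (sub_nonneg.2 (min_le_left _ _))
  · linarith [h8 i]

lemma congr_capacity (hm : IsMarketClearing N t u g gw s f θ z) {v : I → ℝ}
    (hv : ∀ i ∈ N.Ψ, v i = u i) : IsMarketClearing N t v g gw s f θ z :=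
  ⟨hm.1, fun i hi => by rw [hv i hi]; exact hm.2.1 i hi, hm.2.2⟩

end IsMarketClearing

/-- The idle operation, shedding all demand, is a market-clearing solution. -/
lemma isMarketClearing_shedding (N : MultiNetwork I L Ω T) (t : T) {u : I → ℝ}
    (hu : ∀ i ∈ N.Ψ, 0 ≤ u i) :
    IsMarketClearing N t u 0 0 (N.D t) 0 0 0 := by
  refine ⟨fun j => ⟨le_rfl, N.hP j⟩,
    fun i hi => ⟨le_rfl, mul_nonneg (N.hk t i).1 (hu i hi)⟩, fun i _ => rfl, N.hD t,
    fun l => ⟨?_, (N.hfbar l).le⟩, fun i => ⟨?_, N.hθbar.le⟩, fun l => Or.inl rfl,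
    fun i => by simp, fun l => by simp⟩
  · simpa using (N.hfbar l).le
  · simpa using N.hθbar.le

/-- For nonnegative capacities the market-clearing problem of each block has a minimizer. -/
lemma exists_minimal_clearingCost (N : MultiNetwork I L Ω T) (p : Ω → ℝ) (ρ : I → ℝ) (t : T)
    {u : I → ℝ} (hu : ∀ i, 0 ≤ u i) :
    ∃ g gw s f θ z, IsMarketClearing N t u g gw s f θ z ∧
      ∀ g' gw' s' f' θ' z', IsMarketClearing N t u g' gw' s' f' θ' z' →
        clearingCost p ρ g s ≤ clearingCost p ρ g' s' := by
  let K : Set ((Ω → ℝ) × (I → ℝ) × (I → ℝ) × (L → ℝ) × (I → ℝ) × (L → ℝ)) :=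
    {a | IsMarketClearing N t u a.1 a.2.1 a.2.2.1 a.2.2.2.1 a.2.2.2.2.1 a.2.2.2.2.2}
  have hcl : IsClosed K := isClosed_setOf_isMarketClearing N t (by fun_prop) (by fun_prop)
    (by fun_prop) (by fun_prop) (by fun_prop) (by fun_prop) (by fun_prop)
  have hsub : K ⊆ Set.Icc (0, 0, 0, fun l => -N.fbar l, fun _ => -N.θbar, 0)
      (N.P, u, sheddingBound N t, N.fbar, fun _ => N.θbar, 1) := by
    rintro ⟨g, gw, s, f, θ, z⟩ (hm : IsMarketClearing N t u g gw s f θ z)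
    exact ⟨⟨fun j => (hm.1 j).1, hm.wind_nonneg, hm.2.2.2.1, fun l => (hm.2.2.2.2.1 l).1,
        fun i => (hm.2.2.2.2.2.1 i).1, fun l => (hm.switching_mem l).1⟩,
      ⟨fun j => (hm.1 j).2, hm.wind_le hu fun i _ => ⟨hu i, le_rfl⟩, hm.shedding_le,
        fun l => (hm.2.2.2.2.1 l).2, fun i => (hm.2.2.2.2.2.1 i).2,
        fun l => (hm.switching_mem l).2⟩⟩
  have hK : IsCompact K := isCompact_Icc.of_isClosed_subset hcl hsub
  have hne : K.Nonempty :=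
    ⟨(0, 0, N.D t, 0, 0, 0), isMarketClearing_shedding N t fun i _ => hu i⟩
  obtain ⟨⟨g, gw, s, f, θ, z⟩, hm, hmin⟩ := hK.exists_isMinOn hne
    (f := fun a => clearingCost p ρ a.1 a.2.2.1)
    (by unfold clearingCost; fun_prop)
  exact ⟨g, gw, s, f, θ, z, hm, fun g' gw' s' f' θ' z' hm' =>
    hmin (show (g', gw', s', f', θ', z') ∈ K from hm')⟩

/-- Lower-level optimality, with competitors curtailed from arbitrary capacities. -/
lemma forall_clearingCost_le_iff (N : MultiNetwork I L Ω T) (p : Ω → ℝ) (ρ : I → ℝ) (t : T)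
    {u : I → ℝ} (hu : ∀ i ∈ N.Ψ, 0 ≤ u i) (hu' : ∀ i, i ∉ N.Ψ → u i = 0) (b : ℝ) :
    (∀ g gw s f θ z, IsMarketClearing N t u g gw s f θ z → b ≤ clearingCost p ρ g s) ↔
      ∀ v g gw s f θ z, IsMarketClearing N t v g gw s f θ z →
        b ≤ clearingCost p ρ g (fun i => s i + (gw i - min (gw i) (N.k t i * u i))) := by
  refine ⟨fun H v g gw s f θ z hm => H _ _ _ _ _ _ (hm.curtail hu hu'),
    fun H g gw s f θ z hm => ?_⟩
  convert H u g gw s f θ z hm using 2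
  funext i
  have : gw i ≤ N.k t i * u i := by
    by_cases hi : i ∈ N.Ψ
    · exact (hm.2.1 i hi).2
    · simp [hm.2.2.1 i hi, hu' i hi]
  simp [min_eq_left this]

/-- Capacities outside the eligible buses may be reset to zero. -/
lemma Admissible.restrict {N : MultiNetwork I L Ω T} {p : Ω → ℝ} {ρ Ubar C H : I → ℝ}
    {Chat : ℝ} {x u : I → ℝ} {g : T → Ω → ℝ} {gw s : T → I → ℝ} {f : T → L → ℝ}
    {θ : T → I → ℝ} {z : T → L → ℝ}
    (ha : Admissible N p ρ Ubar C H Chat x u g gw s f θ z) :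
    Admissible N p ρ Ubar C H Chat x (fun i => if i ∈ N.Ψ then u i else 0) g gw s f θ z := by
  obtain ⟨h1, h2, h3, h4, h5⟩ := ha
  refine ⟨h1, fun i hi => by simpa [hi] using h2 i hi, ?_,
    fun t => (h4 t).congr_capacity fun i hi => by simp [hi],
    fun t g' gw' s' f' θ' z' hm => h5 t g' gw' s' f' θ' z'
      (hm.congr_capacity fun i hi => by simp [hi])⟩
  convert h3 using 1
  exact sum_congr rfl fun i hi => by simp [hi]

/-- Proposition 1(ii): the bilevel wind power generation planning problem
has an optimal solution: among all admissible tuples (investment plus lower-level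
optimal market-clearing solutions for every demand block), some tuple maximizes the
upper-level objective. -/
theorem bilevel_has_optimal_solution (N : MultiNetwork I L Ω T)
    (p : Ω → ℝ) (ρ : I → ℝ) (hp : ∀ j, 0 ≤ p j) (hρ : ∀ i, 0 < ρ i)
    (κ : ℝ) (hκ : 0 < κ) (Lt : T → ℝ) (hLt : ∀ t, 0 < Lt t)
    (c h C H Ubar : I → ℝ)
    (hc : ∀ i, 0 ≤ c i) (hh : ∀ i, 0 ≤ h i) (hC : ∀ i, 0 ≤ C i)
    (hH : ∀ i, 0 ≤ H i) (hUbar : ∀ i, 0 ≤ Ubar i)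
    (Chat : ℝ) (hChat : 0 ≤ Chat) :
    ∃ (x u : I → ℝ) (g : T → Ω → ℝ) (gw s : T → I → ℝ) (f : T → L → ℝ)
      (θ : T → I → ℝ) (z : T → L → ℝ),
      Admissible N p ρ Ubar C H Chat x u g gw s f θ z ∧
      ∀ (x' u' : I → ℝ) (g' : T → Ω → ℝ) (gw' s' : T → I → ℝ) (f' : T → L → ℝ)
        (θ' : T → I → ℝ) (z' : T → L → ℝ),
        Admissible N p ρ Ubar C H Chat x' u' g' gw' s' f' θ' z' →
        κ * (∑ t, Lt t * ∑ i ∈ N.Ψ, gw' t i) - (∑ i ∈ N.Ψ, (c i * u' i + h i * x' i))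
          ≤ κ * (∑ t, Lt t * ∑ i ∈ N.Ψ, gw t i)
            - ∑ i ∈ N.Ψ, (c i * u i + h i * x i) := by
  let K : Set ((I → ℝ) × (I → ℝ) × (T → Ω → ℝ) × (T → I → ℝ) × (T → I → ℝ) × (T → L → ℝ) ×
      (T → I → ℝ) × (T → L → ℝ)) := {a | Admissible N p ρ Ubar C H Chat a.1 a.2.1 a.2.2.1 a.2.2.2.1 a.2.2.2.2.1
    a.2.2.2.2.2.1 a.2.2.2.2.2.2.1 a.2.2.2.2.2.2.2 ∧ ∀ i, i ∉ N.Ψ → a.2.1 i = 0}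
  have hK_eq : K = {a | (∀ i, a.1 i = 0 ∨ a.1 i = 1) ∧
      (∀ i ∈ N.Ψ, 0 ≤ a.2.1 i ∧ a.2.1 i ≤ Ubar i * a.1 i) ∧
      (∑ i ∈ N.Ψ, (C i * a.2.1 i + H i * a.1 i)) ≤ Chat ∧
      (∀ i, i ∉ N.Ψ → a.2.1 i = 0) ∧
      (∀ t, IsMarketClearing N t a.2.1 (a.2.2.1 t) (a.2.2.2.1 t) (a.2.2.2.2.1 t)
        (a.2.2.2.2.2.1 t) (a.2.2.2.2.2.2.1 t) (a.2.2.2.2.2.2.2 t)) ∧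
      (∀ t v g gw s f θ z, IsMarketClearing N t v g gw s f θ z →
        clearingCost p ρ (a.2.2.1 t) (a.2.2.2.2.1 t) ≤
          clearingCost p ρ g (fun i => s i + (gw i - min (gw i) (N.k t i * a.2.1 i))))} := by
    ext a
    constructor
    · rintro ⟨⟨h1, h2, h3, h4, h5⟩, h6⟩
      exact ⟨h1, h2, h3, h6, h4, fun t => (forall_clearingCost_le_iff N p ρ t
        (fun i hi => (h2 i hi).1) h6 _).1 (h5 t)⟩
    · rintro ⟨h1, h2, h3, h6, h4, h5⟩
      exact ⟨⟨h1, h2, h3, h4, fun t => (forall_clearingCost_le_iff N p ρ t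
        (fun i hi => (h2 i hi).1) h6 _).2 (h5 t)⟩, h6⟩
  have hcl : IsClosed K := by
    rw [hK_eq]
    simp only [Set.ofPred_and, Set.ofPred_forall, Set.ofPred_or]
    refine IsClosed.inter ?_ <| IsClosed.inter ?_ <| IsClosed.inter ?_ <| IsClosed.inter ?_ <|
      IsClosed.inter ?_ ?_
    · exact isClosed_iInter fun i => (isClosed_eq (by fun_prop) (by fun_prop)).union
        (isClosed_eq (by fun_prop) (by fun_prop))
    · exact isClosed_iInter fun i => isClosed_iInter fun _ =>
        (isClosed_le (by fun_prop) (by fun_prop)).inter (isClosed_le (by fun_prop) (by fun_prop))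
    · exact isClosed_le (by fun_prop) (by fun_prop)
    · exact isClosed_iInter fun i => isClosed_iInter fun _ =>
        isClosed_eq (by fun_prop) (by fun_prop)
    · exact isClosed_iInter fun t => isClosed_setOf_isMarketClearing N t (by fun_prop)
        (by fun_prop) (by fun_prop) (by fun_prop) (by fun_prop) (by fun_prop) (by fun_prop)
    · refine isClosed_iInter fun t => isClosed_iInter fun v => isClosed_iInter fun g =>
        isClosed_iInter fun gw => isClosed_iInter fun s => isClosed_iInter fun f =>
        isClosed_iInter fun θ => isClosed_iInter fun z => isClosed_iInter fun _ => ?_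
      unfold clearingCost
      exact isClosed_le (by fun_prop) (by fun_prop)
  have hsub : K ⊆ Set.Icc
      (0, 0, 0, 0, 0, fun _ l => -N.fbar l, fun _ _ => -N.θbar, 0)
      (1, Ubar, fun _ => N.P, fun _ => Ubar, sheddingBound N, fun _ => N.fbar,
        fun _ _ => N.θbar, 1) := by
    rintro ⟨x, u, g, gw, s, f, θ, z⟩ ⟨⟨hx, hu, -, hm, -⟩, hu0⟩
    dsimp only at hx hu hm hu0
    have hx01 : ∀ i, 0 ≤ x i ∧ x i ≤ 1 := fun i => by rcases hx i with h | h <;> simp [h]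
    have huU : ∀ i ∈ N.Ψ, 0 ≤ u i ∧ u i ≤ Ubar i := fun i hi =>
      ⟨(hu i hi).1, (hu i hi).2.trans (mul_le_of_le_one_right (hUbar i) (hx01 i).2)⟩
    have huU' : ∀ i, 0 ≤ u i ∧ u i ≤ Ubar i := fun i => by
      by_cases hi : i ∈ N.Ψ
      · exact huU i hi
      · rw [hu0 i hi]
        exact ⟨le_rfl, hUbar i⟩
    exact ⟨⟨fun i => (hx01 i).1, fun i => (huU' i).1, fun t j => ((hm t).1 j).1,
        fun t => (hm t).wind_nonneg, fun t => (hm t).2.2.2.1, fun t l => ((hm t).2.2.2.2.1 l).1,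
        fun t i => ((hm t).2.2.2.2.2.1 i).1, fun t l => ((hm t).switching_mem l).1⟩,
      ⟨fun i => (hx01 i).2, fun i => (huU' i).2, fun t j => ((hm t).1 j).2,
        fun t => (hm t).wind_le hUbar huU, fun t => (hm t).shedding_le,
        fun t l => ((hm t).2.2.2.2.1 l).2, fun t i => ((hm t).2.2.2.2.2.1 i).2,
        fun t l => ((hm t).switching_mem l).2⟩⟩
  have hK : IsCompact K := isCompact_Icc.of_isClosed_subset hcl hsub
  have hne : K.Nonempty := by
    choose g gw s f θ z hm hmin using fun t =>
      exists_minimal_clearingCost N p ρ t (u := 0) fun _ => le_rfl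
    exact ⟨(0, 0, g, gw, s, f, θ, z), ⟨fun i => Or.inl rfl, fun i _ => by simp,
      by simpa using hChat, hm, hmin⟩, fun i _ => rfl⟩
  obtain ⟨⟨x, u, g, gw, s, f, θ, z⟩, ha, hmax⟩ := hK.exists_isMaxOn hne
    (f := fun a => κ * (∑ t, Lt t * ∑ i ∈ N.Ψ, a.2.2.2.1 t i)
      - ∑ i ∈ N.Ψ, (c i * a.2.1 i + h i * a.1 i)) (by fun_prop)
  refine ⟨x, u, g, gw, s, f, θ, z, ha.1, fun x' u' g' gw' s' f' θ' z' ha' => ?_⟩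
  have hle := hmax (show (x', _, g', gw', s', f', θ', z') ∈ K from
    ⟨ha'.restrict, fun i hi => if_neg hi⟩)
  have hsum : ∑ i ∈ N.Ψ, (c i * (if i ∈ N.Ψ then u' i else 0) + h i * x' i)
      = ∑ i ∈ N.Ψ, (c i * u' i + h i * x' i) := sum_congr rfl fun i hi => by simp [hi]
  rw [← hsum]
  exact hle
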